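/- For all 0 < x < y, the partial derivatives of V satisfy V_x(x,y) − V_y(x,y) = 2 exp(−2x) · Φ((y−2x)/√(y−x)), which is strictly positive; for all 0 < y < x, V_x(x,y) − V_y(x,y) = −2 exp(−2y) · Φ((x−2y)/√(x−y)) < 0; and V_x(x,x) = V_y(x,x) for all x > 0. Consequently {(x,y) ∈ (0,∞)² : V_x(x,y) > V_y(x,y)} = {(x,y) ∈ (0,∞)² : x < y}. -/

import Mathlib

open MeasureTheory Set Filter

noncomputable def Phi (z : ℝ) : ℝ :=
  (Real.sqrt (2 * Real.pi))⁻¹ * ∫ u in Set.Iio z, Real.exp (-(u ^ 2) / 2)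

open Classical in
/-- The explicit value function for `ρ = 1`, `δ = 0`, `μ̄ = 1`. -/
noncomputable def Vfun (x y : ℝ) : ℝ :=
  if x = y then 1 - Real.exp (-x)
  else
    Phi (max x y / Real.sqrt |y - x|)
      - Real.exp (-2 * min x y) * Phi ((|y - x| - min x y) / Real.sqrt |y - x|)
      - Real.exp (-(x + y) / 2) * (2 * Phi (min x y / Real.sqrt |y - x|) - 1)

/-- Partial derivative of `Vfun` in the first variable. -/
noncomputable def Vx (x y : ℝ) : ℝ := deriv (fun x' => Vfun x' y) x

/-- Partial derivative of `Vfun` in the second variable. -/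
noncomputable def Vy (x y : ℝ) : ℝ := deriv (fun y' => Vfun x y') y

/-- Second partial derivative of `Vfun` in the first variable. -/
noncomputable def Vxx (x y : ℝ) : ℝ := deriv (fun x' => Vx x' y) x

/-- Second partial derivative of `Vfun` in the second variable. -/
noncomputable def Vyy (x y : ℝ) : ℝ := deriv (fun y' => Vy x y') y

/-- Mixed second partial derivative of `Vfun`. -/
noncomputable def Vxy (x y : ℝ) : ℝ := deriv (fun y' => Vx x y') y

lemma aux_int : Integrable (fun u : ℝ => Real.exp (-(u ^ 2) / 2)) := by
  have h := integrable_exp_neg_mul_sq (b := 1 / 2) (by norm_num)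
  refine h.congr (Eventually.of_forall fun u => ?_)
  show Real.exp _ = Real.exp _
  congr 1
  ring

lemma aux_Phi_deriv (z : ℝ) :
    HasDerivAt Phi ((Real.sqrt (2 * Real.pi))⁻¹ * Real.exp (-(z ^ 2) / 2)) z := by
  have hc : Continuous (fun u : ℝ => Real.exp (-(u ^ 2) / 2)) := by fun_prop
  have h1 : HasDerivAt (fun z : ℝ => ∫ u in (0 : ℝ)..z, Real.exp (-(u ^ 2) / 2))
      (Real.exp (-(z ^ 2) / 2)) z :=
    intervalIntegral.integral_hasDerivAt_right (hc.intervalIntegrable _ _)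
      (hc.stronglyMeasurableAtFilter _ _) hc.continuousAt
  have h2 : Phi = fun z => (Real.sqrt (2 * Real.pi))⁻¹ *
      ((∫ u in (0 : ℝ)..z, Real.exp (-(u ^ 2) / 2))
        + ∫ u in Set.Iic (0 : ℝ), Real.exp (-(u ^ 2) / 2)) := by
    funext z
    unfold Phi
    rw [← integral_Iic_eq_integral_Iio,
      ← intervalIntegral.integral_Iic_sub_Iic aux_int.integrableOn aux_int.integrableOn]
    ring
  rw [h2]
  exact (h1.add_const _).const_mul _

lemma aux_Phi_pos (z : ℝ) : 0 < Phi z := by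
  unfold Phi
  refine mul_pos (by positivity) ?_
  rw [setIntegral_pos_iff_support_of_nonneg_ae
    (Eventually.of_forall fun u => (Real.exp_pos _).le) aux_int.integrableOn]
  have : Function.support (fun u : ℝ => Real.exp (-(u ^ 2) / 2)) = Set.univ := by
    ext u
    simp
  rw [this]
  simp

lemma aux_symm (x y : ℝ) : Vfun x y = Vfun y x := by
  unfold Vfun
  by_cases h : x = y
  · subst h; rfl
  · rw [if_neg h, if_neg (Ne.symm h), max_comm, min_comm, abs_sub_comm, add_comm x y]

lemma aux_swap (x y : ℝ) : Vx x y = Vy y x := by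
  unfold Vx Vy
  congr 1
  funext t
  exact aux_symm t y

lemma aux_deriv (a b : ℝ → ℝ) (a' b' t : ℝ) (ha : HasDerivAt a a' t) (hb : HasDerivAt b b' t)
    (h : a t < b t) :
    HasDerivAt (fun t => Vfun (a t) (b t))
      ((Real.sqrt (2 * Real.pi))⁻¹ * Real.exp (-((b t / √(b t - a t)) ^ 2) / 2)
          * ((b' * √(b t - a t) - b t * ((b' - a') / (2 * √(b t - a t)))) / √(b t - a t) ^ 2)
        - (Real.exp (-2 * a t) * (-2 * a') * Phi ((b t - a t - a t) / √(b t - a t))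
          + Real.exp (-2 * a t) * ((Real.sqrt (2 * Real.pi))⁻¹ *
              Real.exp (-(((b t - a t - a t) / √(b t - a t)) ^ 2) / 2)
            * (((b' - a' - a') * √(b t - a t) - (b t - a t - a t) * ((b' - a') / (2 * √(b t - a t))))
              / √(b t - a t) ^ 2)))
        - (Real.exp (-(a t + b t) / 2) * (-(a' + b') / 2) * (2 * Phi (a t / √(b t - a t)) - 1)
          + Real.exp (-(a t + b t) / 2) * (2 * ((Real.sqrt (2 * Real.pi))⁻¹ *
              Real.exp (-((a t / √(b t - a t)) ^ 2) / 2)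
            * ((a' * √(b t - a t) - a t * ((b' - a') / (2 * √(b t - a t))))
              / √(b t - a t) ^ 2))))) t := by
  have hw : 0 < b t - a t := sub_pos.2 h
  have hs0 : √(b t - a t) ≠ 0 := (Real.sqrt_pos.2 hw).ne'
  have hs : HasDerivAt (fun t => √(b t - a t)) ((b' - a') / (2 * √(b t - a t))) t :=
    (hb.sub ha).sqrt hw.ne'
  have e1 := (aux_Phi_deriv (b t / √(b t - a t))).comp t (hb.div hs hs0)
  have e2 := (aux_Phi_deriv ((b t - a t - a t) / √(b t - a t))).comp t
    (((hb.sub ha).sub ha).div hs hs0)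
  have e3 := (aux_Phi_deriv (a t / √(b t - a t))).comp t (ha.div hs hs0)
  have x2 := (ha.const_mul (-2)).exp
  have x3 := ((ha.add hb).neg.div_const 2).exp
  have key := (e1.sub (x2.mul e2)).sub (x3.mul ((e3.const_mul 2).sub_const 1))
  refine key.congr_of_eventuallyEq ?_
  have hev : ∀ᶠ u in nhds t, a u < b u :=
    ha.continuousAt.eventually_lt hb.continuousAt h
  filter_upwards [hev] with u hu
  unfold Vfun
  rw [if_neg hu.ne, max_eq_right hu.le, min_eq_left hu.le, abs_of_pos (sub_pos.2 hu)]
  rfl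

lemma aux_main (x y : ℝ) (h : x < y) :
    Vx x y - Vy x y = 2 * Real.exp (-2 * x) * Phi ((y - 2 * x) / Real.sqrt (y - x)) := by
  have h1 : Vx x y = _ :=
    (aux_deriv (fun t => t) (fun _ => y) 1 0 x (hasDerivAt_id x) (hasDerivAt_const x y) h).deriv
  have h2 : Vy x y = _ :=
    (aux_deriv (fun _ => x) (fun t => t) 0 1 y (hasDerivAt_const y x) (hasDerivAt_id y) h).deriv
  rw [h1, h2]
  have hw : 0 < y - x := sub_pos.2 h
  have hs := Real.sq_sqrt hw.le
  have hs0 : √(y - x) ≠ 0 := (Real.sqrt_pos.2 hw).ne'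
  have g2 : Real.exp (-(((y - x - x) / √(y - x)) ^ 2) / 2)
      = Real.exp (2 * x) * Real.exp (-((y / √(y - x)) ^ 2) / 2) := by
    rw [← Real.exp_add, div_pow, div_pow, hs]
    congr 1
    field_simp
    ring
  have g3 : Real.exp (-((x / √(y - x)) ^ 2) / 2)
      = Real.exp ((x + y) / 2) * Real.exp (-((y / √(y - x)) ^ 2) / 2) := by
    rw [← Real.exp_add, div_pow, div_pow, hs]
    congr 1
    field_simp
    ring
  have k2 : Real.exp (-2 * x) * Real.exp (2 * x) = 1 := by
    rw [← Real.exp_add]; simp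
  have k3 : Real.exp (-(x + y) / 2) * Real.exp ((x + y) / 2) = 1 := by
    rw [← Real.exp_add, ← Real.exp_zero]; congr 1; ring
  have e : y - 2 * x = y - x - x := by ring
  rw [g2, g3, e]
  generalize Phi ((y - x - x) / √(y - x)) = P
  generalize Phi (x / √(y - x)) = Q
  generalize Real.exp (-((y / √(y - x)) ^ 2) / 2) = E
  generalize Real.exp (-2 * x) = A at *
  generalize Real.exp (2 * x) = A' at *
  generalize Real.exp (-(x + y) / 2) = B at *
  generalize Real.exp ((x + y) / 2) = B' at *
  generalize (Real.sqrt (2 * Real.pi))⁻¹ = c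
  generalize √(y - x) = s at *
  have hy : y = s ^ 2 + x := by linarith
  subst hy
  have : A' = A⁻¹ := eq_inv_of_mul_eq_one_right k2
  have hA : A ≠ 0 := left_ne_zero_of_mul_eq_one k2
  have hB : B ≠ 0 := left_ne_zero_of_mul_eq_one k3
  have : B' = B⁻¹ := eq_inv_of_mul_eq_one_right k3
  subst A' B'
  field_simp
  ring


theorem stmt10 :
    (∀ x y : ℝ, 0 < x → x < y →
        Vx x y - Vy x y = 2 * Real.exp (-2 * x) * Phi ((y - 2 * x) / Real.sqrt (y - x))
        ∧ 0 < Vx x y - Vy x y)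
    ∧ (∀ x y : ℝ, 0 < y → y < x →
        Vx x y - Vy x y = -(2 * Real.exp (-2 * y) * Phi ((x - 2 * y) / Real.sqrt (x - y)))
        ∧ Vx x y - Vy x y < 0)
    ∧ (∀ x : ℝ, 0 < x → Vx x x = Vy x x)
    ∧ {p : ℝ × ℝ | p ∈ Set.Ioi (0 : ℝ) ×ˢ Set.Ioi (0 : ℝ) ∧ Vy p.1 p.2 < Vx p.1 p.2}
        = {p : ℝ × ℝ | p ∈ Set.Ioi (0 : ℝ) ×ˢ Set.Ioi (0 : ℝ) ∧ p.1 < p.2} := by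
  have H1 : ∀ x y : ℝ, x < y → 0 < Vx x y - Vy x y := by
    intro x y h
    rw [aux_main x y h]
    have := aux_Phi_pos ((y - 2 * x) / Real.sqrt (y - x))
    positivity
  have H2 : ∀ x y : ℝ, Vx x y - Vy x y = -(Vx y x - Vy y x) := by
    intro x y
    rw [aux_swap x y, aux_swap y x]
    ring
  refine ⟨fun x y _ h => ⟨aux_main x y h, H1 x y h⟩, fun x y _ h => ⟨?_, ?_⟩,
    fun x _ => aux_swap x x, ?_⟩
  · rw [H2, aux_main y x h]
  · rw [H2]
    linarith [H1 y x h]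
  · ext ⟨x, y⟩
    simp only [Set.mem_ofPred_eq]
    refine and_congr_right fun _ => ⟨fun h => ?_, fun h => by linarith [H1 x y h]⟩
    by_contra hn
    rcases (not_lt.1 hn).lt_or_eq with h' | h'
    · linarith [H1 y x h', H2 x y]
    · subst h'
      exact absurd h (by rw [aux_swap]; exact lt_irrefl _)
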